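/- arXiv:2011.07135 — 6 statements merged into one kernel-verified Lean document; each statement's English description precedes it below -/
import Mathlib

section
/- (Combinatorial form of the main theorem, non-horospherical case.) Suppose L(id) > 0, where id(t) = t; since L is linear in g and vanishes on constants, this is equivalent to L(g) > 0 for every non-constant non-decreasing affine g, i.e., to K-stability with respect to the unique G-equivariant special test configuration. Then there exists ε > 0 such that for every non-decreasing convex continuous function g : [s₋, s₊] → ℝ one has L(g) ≥ ε·J(g). -/
/-- A convex non-decreasing function on `[x, y]` admits, for a weight `D` which is negative exactly
on an open order-connected set, a non-decreasing affine function below it at the endpoints such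
that the difference has the same sign as `D`. -/
lemma exists_affine_sub_mul_nonneg {x y : ℝ} (hxy : x < y) {g D : ℝ → ℝ}
    (hD : Continuous D) (hS : (Set.Ioo x y ∩ {t | D t < 0}).OrdConnected)
    (hg : ConvexOn ℝ (Set.Icc x y) g) (hm : MonotoneOn g (Set.Icc x y)) :
    ∃ α β : ℝ, 0 ≤ β ∧ α + β * x ≤ g x ∧ α + β * y ≤ g y ∧
      ∀ t ∈ Set.Ioo x y, 0 ≤ (g t - (α + β * t)) * D t := by
  set S := Set.Ioo x y ∩ {t | D t < 0} with hSdef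
  have hSo : IsOpen S := isOpen_Ioo.inter (isOpen_lt hD continuous_const)
  rcases S.eq_empty_or_nonempty with hE | hne
  · refine ⟨g x, 0, le_rfl, by simp, ?_, fun t ht => ?_⟩
    · simpa using hm (Set.left_mem_Icc.2 hxy.le) (Set.right_mem_Icc.2 hxy.le) hxy.le
    · have h1 : g x ≤ g t :=
        hm (Set.left_mem_Icc.2 hxy.le) (Set.Ioo_subset_Icc_self ht) ht.1.le
      have h2 : 0 ≤ D t := by
        by_contra! h
        exact (Set.eq_empty_iff_forall_notMem.1 hE t) ⟨ht, h⟩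
      exact mul_nonneg (by linarith) h2
  have hbb : BddBelow S := ⟨x, fun t ht => ht.1.1.le⟩
  have hba : BddAbove S := ⟨y, fun t ht => ht.1.2.le⟩
  obtain ⟨s, hs⟩ := hne
  obtain ⟨p, hp⟩ : ∃ p, p = sInf S := ⟨_, rfl⟩
  obtain ⟨q, hq⟩ : ∃ q, q = sSup S := ⟨_, rfl⟩
  have hpq : p < q := by
    by_contra! h
    refine not_isOpen_singleton s ?_
    have : S = {s} := Set.Subset.antisymm (fun t ht => ?_) (by simpa using hs)
    · rwa [← this]
    · have := csInf_le hbb ht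
      have := csInf_le hbb hs
      have := le_csSup hba ht
      have := le_csSup hba hs
      exact le_antisymm (by linarith) (by linarith)
  have hxp : x ≤ p := hp ▸ le_csInf ⟨s, hs⟩ fun t ht => ht.1.1.le
  have hqy : q ≤ y := hq ▸ csSup_le ⟨s, hs⟩ fun t ht => ht.1.2.le
  have hpI : p ∈ Set.Icc x y := ⟨hxp, by linarith⟩
  have hqI : q ∈ Set.Icc x y := ⟨by linarith, hqy⟩
  obtain ⟨β, hβ⟩ : ∃ β, β = (g q - g p) / (q - p) := ⟨_, rfl⟩
  have hβq : g q - g p = β * (q - p) := by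
    rw [hβ, div_mul_cancel₀ _ (sub_pos.2 hpq).ne']
  have hleft : ∀ t ∈ Set.Icc x y, t ≤ p → g p - β * p + β * t ≤ g t := by
    intro t ht htp
    rcases htp.eq_or_lt with rfl | htp
    · linarith
    have h := hg.slope_mono_adjacent ht hqI htp hpq
    rw [← hβ, div_le_iff₀ (sub_pos.2 htp)] at h
    linarith
  have hright : ∀ t ∈ Set.Icc x y, q ≤ t → g p - β * p + β * t ≤ g t := by
    intro t ht hqt
    rcases hqt.eq_or_lt with rfl | hqt
    · linarith
    have h := hg.slope_mono_adjacent hpI ht hpq hqt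
    rw [← hβ, le_div_iff₀ (sub_pos.2 hqt)] at h
    linarith
  refine ⟨g p - β * p, β, ?_, hleft x (Set.left_mem_Icc.2 hxy.le) hxp,
    hright y (Set.right_mem_Icc.2 hxy.le) hqy, fun t ht => ?_⟩
  · rw [hβ]
    exact div_nonneg (sub_nonneg.2 (hm hpI hqI hpq.le)) (sub_pos.2 hpq).le
  have htI := Set.Ioo_subset_Icc_self ht
  have hout : t ∉ S → 0 ≤ D t := fun h => not_lt.1 fun h' => h ⟨ht, h'⟩
  rcases lt_or_ge t p with htp | hpt
  · exact mul_nonneg (sub_nonneg.2 (hleft t htI htp.le))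
      (hout fun h => by linarith [csInf_le hbb h])
  rcases lt_or_ge q t with hqt | htq
  · exact mul_nonneg (sub_nonneg.2 (hright t htI hqt.le))
      (hout fun h => by linarith [le_csSup hba h])
  rcases hpt.eq_or_lt with rfl | hpt
  · simp
  rcases htq.eq_or_lt with rfl | htq
  · rw [show g t - (g p - β * p + β * t) = 0 by linarith, zero_mul]
  obtain ⟨u, hu, hut⟩ := exists_lt_of_csInf_lt ⟨s, hs⟩ (hp ▸ hpt)
  obtain ⟨v, hv, htv⟩ := exists_lt_of_lt_csSup ⟨s, hs⟩ (hq ▸ htq)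
  have hDt : D t < 0 := (hS.out hu hv ⟨hut.le, htv.le⟩).2
  refine mul_nonneg_of_nonpos_of_nonpos ?_ hDt.le
  have h := hg.slope_mono_adjacent hpI hqI hpt htq
  rw [div_le_div_iff₀ (sub_pos.2 hpt) (sub_pos.2 htq)] at h
  by_contra! hc
  nlinarith [mul_pos hc (sub_pos.2 hpq)]

/-- A finite sum of functions `w i / (b i + c i * t)` is convex where the denominators are
positive. -/
lemma convexOn_sum_div_affine {ι : Type*} [Fintype ι] {s : Set ℝ} (hs : Convex ℝ s)
    {b c w : ι → ℝ} (hw : ∀ i, 0 ≤ w i) (hpos : ∀ i, ∀ t ∈ s, 0 < b i + c i * t) :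
    ConvexOn ℝ s fun t => ∑ i, w i / (b i + c i * t) := by
  refine ⟨hs, fun u hu v hv k l hk hl hkl => ?_⟩
  simp only [smul_eq_mul, Finset.mul_sum, ← Finset.sum_add_distrib]
  refine Finset.sum_le_sum fun i _ => ?_
  have h1 := hpos i u hu
  have h2 := hpos i v hv
  have h := (convexOn_zpow (𝕜 := ℝ) (-1)).2 (x := b i + c i * u) h1 (y := b i + c i * v) h2
    hk hl hkl
  simp only [smul_eq_mul, zpow_neg_one] at h
  have h3 : b i + c i * (k * u + l * v) = k * (b i + c i * u) + l * (b i + c i * v) := by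
    linear_combination (-b i) * hkl
  rw [h3, div_eq_mul_inv, div_eq_mul_inv, div_eq_mul_inv]
  calc _ ≤ w i * _ := mul_le_mul_of_nonneg_left h (hw i)
    _ = _ := by ring

/-- Combinatorial form of the main theorem of Delcroix's paper, non-horospherical case:
if `L(id) > 0` (K-stability with respect to the unique `G`-equivariant special test
configuration), then there is `ε > 0` with `L(g) ≥ ε·J(g)` for every non-decreasing
convex continuous `g : [s₋, s₊] → ℝ` (G-uniform K-stability). -/
theorem uniform_K_stability_non_horospherical
    {ι : Type*} [Fintype ι] [DecidableEq ι] [Nonempty ι]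
    (sLo sHi : ℝ) (hs : sLo < sHi)
    (b c w : ι → ℝ)
    (hw : ∀ i, 0 < w i)
    (hpos : ∀ i, ∀ t ∈ Set.Ioo sLo sHi, 0 < b i + c i * t)
    (P Q : ℝ → ℝ)
    (hP : ∀ t, P t = ∏ i, (b i + c i * t) / w i)
    (hQ : ∀ t, Q t = ∑ i, ∏ j ∈ Finset.univ.erase i, (b j + c j * t) / w j)
    (a : ℝ)
    (ha : a = (P sLo + P sHi + 2 * ∫ t in sLo..sHi, Q t) / (2 * ∫ t in sLo..sHi, P t))
    (L J : (ℝ → ℝ) → ℝ)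
    (hL : ∀ g, L g = g sLo * P sLo + g sHi * P sHi
      - ∫ t in sLo..sHi, 2 * g t * (a * P t - Q t))
    (hJ : ∀ g, J g = ∫ t in sLo..sHi, (g t - sInf (g '' Set.Icc sLo sHi)) * P t)
    (hstab : L (fun t => t) > 0) :
    ∃ ε > 0, ∀ g : ℝ → ℝ, ContinuousOn g (Set.Icc sLo sHi) →
      ConvexOn ℝ (Set.Icc sLo sHi) g → MonotoneOn g (Set.Icc sLo sHi) →
        L g ≥ ε * J g := by
  have hPc : Continuous P := by rw [funext hP]; fun_prop
  have hQc : Continuous Q := by rw [funext hQ]; fun_prop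
  have hPpos : ∀ t ∈ Set.Ioo sLo sHi, 0 < P t := fun t ht => by
    rw [hP]
    exact Finset.prod_pos fun i _ => div_pos (hpos i t ht) (hw i)
  have hPnn : ∀ t ∈ Set.Icc sLo sHi, 0 ≤ P t := by
    rw [← closure_Ioo hs.ne]
    exact fun t ht => le_on_closure (f := fun _ => (0 : ℝ)) (fun t ht => (hPpos t ht).le)
      continuousOn_const hPc.continuousOn ht
  have hPLo : 0 ≤ P sLo := hPnn _ (Set.left_mem_Icc.2 hs.le)
  have hPHi : 0 ≤ P sHi := hPnn _ (Set.right_mem_Icc.2 hs.le)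
  have hIP : 0 < ∫ t in sLo..sHi, P t :=
    intervalIntegral.intervalIntegral_pos_of_pos_on (hPc.intervalIntegrable _ _) hPpos hs
  have hQP : ∀ t ∈ Set.Ioo sLo sHi, Q t = (∑ i, w i / (b i + c i * t)) * P t := by
    intro t ht
    rw [hQ, hP, Finset.sum_mul]
    refine Finset.sum_congr rfl fun i _ => ?_
    rw [← Finset.mul_prod_erase _ _ (Finset.mem_univ i), ← mul_assoc, ← inv_div,
      inv_mul_cancel₀ (div_pos (hpos i t ht) (hw i)).ne', one_mul]
  obtain ⟨ε, hε, hεid⟩ : ∃ ε > 0, ε * J (fun t => t) ≤ L (fun t => t) := by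
    have hN : 0 < |J (fun t => t)| + 1 := by positivity
    refine ⟨L (fun t => t) / (|J (fun t => t)| + 1), div_pos hstab hN, ?_⟩
    rw [div_mul_eq_mul_div, div_le_iff₀ hN]
    exact mul_le_mul_of_nonneg_left (by linarith [le_abs_self (J fun t => t)]) hstab.le
  refine ⟨ε, hε, fun g hgc hgconv hgm => ?_⟩
  set D : ℝ → ℝ := fun t => Q t - (a + ε / 2) * P t with hDdef
  have hDc : Continuous D := by fun_prop
  have hS : (Set.Ioo sLo sHi ∩ {t | D t < 0}).OrdConnected := by
    have hconv := convexOn_sum_div_affine (convex_Ioo sLo sHi) (fun i => (hw i).le) hpos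
    have : Set.Ioo sLo sHi ∩ {t | D t < 0} =
        {t ∈ Set.Ioo sLo sHi | ∑ i, w i / (b i + c i * t) < a + ε / 2} := by
      ext t
      refine and_congr_right fun ht => ?_
      rw [Set.mem_ofPred_eq, hDdef]
      simp only
      rw [hQP t ht, sub_neg, mul_lt_mul_iff_left₀ (hPpos t ht)]
    rw [this]
    exact (hconv.convex_lt _).ordConnected
  obtain ⟨α, β, hβ, hLo, hHi, hsign⟩ := exists_affine_sub_mul_nonneg hs hDc hS hgconv hgm
  have hii : ∀ {f : ℝ → ℝ}, ContinuousOn f (Set.Icc sLo sHi) →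
      IntervalIntegrable f MeasureTheory.volume sLo sHi := fun h =>
    ContinuousOn.intervalIntegrable (by rwa [Set.uIcc_of_le hs.le])
  have hLJ : ∀ f : ℝ → ℝ, ContinuousOn f (Set.Icc sLo sHi) → MonotoneOn f (Set.Icc sLo sHi) →
      L f - ε * J f = f sLo * (P sLo + ε * ∫ t in sLo..sHi, P t) + f sHi * P sHi
        + 2 * ∫ t in sLo..sHi, f t * D t := by
    intro f hf hfm
    have hmin : sInf (f '' Set.Icc sLo sHi) = f sLo :=
      (hfm.map_isLeast (isLeast_Icc hs.le)).csInf_eq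
    have hfP : IntervalIntegrable (fun t => f t * P t) MeasureTheory.volume sLo sHi :=
      hii (hf.mul hPc.continuousOn)
    have hfQ : IntervalIntegrable (fun t => f t * Q t) MeasureTheory.volume sLo sHi :=
      hii (hf.mul hQc.continuousOn)
    have e1 : ∫ t in sLo..sHi, 2 * f t * (a * P t - Q t) =
        2 * a * (∫ t in sLo..sHi, f t * P t) - 2 * ∫ t in sLo..sHi, f t * Q t := by
      rw [← intervalIntegral.integral_const_mul, ← intervalIntegral.integral_const_mul,
        ← intervalIntegral.integral_sub (hfP.const_mul _) (hfQ.const_mul _)]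
      congr 1; ext t; ring
    have e2 : ∫ t in sLo..sHi, (f t - f sLo) * P t =
        (∫ t in sLo..sHi, f t * P t) - f sLo * ∫ t in sLo..sHi, P t := by
      rw [← intervalIntegral.integral_const_mul,
        ← intervalIntegral.integral_sub hfP ((hPc.intervalIntegrable _ _).const_mul _)]
      congr 1; ext t; ring
    have e3 : ∫ t in sLo..sHi, f t * D t =
        (∫ t in sLo..sHi, f t * Q t) - (a + ε / 2) * ∫ t in sLo..sHi, f t * P t := by
      rw [← intervalIntegral.integral_const_mul,
        ← intervalIntegral.integral_sub hfQ (hfP.const_mul _)]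
      congr 1; ext t; simp only [hDdef]; ring
    rw [hL, hJ, hmin, e1, e2, e3]
    ring
  have hone : P sLo + (ε * ∫ t in sLo..sHi, P t) + P sHi + 2 * ∫ t in sLo..sHi, D t = 0 := by
    have e : ∫ t in sLo..sHi, D t =
        (∫ t in sLo..sHi, Q t) - (a + ε / 2) * ∫ t in sLo..sHi, P t := by
      rw [← intervalIntegral.integral_const_mul, ← intervalIntegral.integral_sub
        (hQc.intervalIntegrable _ _) ((hPc.intervalIntegrable _ _).const_mul _)]
    have ha' := (eq_div_iff (by positivity)).1 ha
    rw [e]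
    linear_combination -ha'
  have hid := hLJ (fun t => t) continuousOn_id monotoneOn_id
  have hgD : IntervalIntegrable (fun t => g t * D t) MeasureTheory.volume sLo sHi :=
    hii (hgc.mul hDc.continuousOn)
  have htD : IntervalIntegrable (fun t => t * D t) MeasureTheory.volume sLo sHi :=
    (continuous_id.mul hDc).intervalIntegrable _ _
  have hsplit : ∫ t in sLo..sHi, (g t - (α + β * t)) * D t = (∫ t in sLo..sHi, g t * D t)
      - (α * (∫ t in sLo..sHi, D t) + β * ∫ t in sLo..sHi, t * D t) := by
    rw [← intervalIntegral.integral_const_mul, ← intervalIntegral.integral_const_mul,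
      ← intervalIntegral.integral_add ((hDc.intervalIntegrable _ _).const_mul _)
        (htD.const_mul _),
      ← intervalIntegral.integral_sub hgD
        (((hDc.intervalIntegrable _ _).const_mul _).add (htD.const_mul _))]
    congr 1; ext t; ring
  have hnn : 0 ≤ ∫ t in sLo..sHi, (g t - (α + β * t)) * D t := by
    rw [intervalIntegral.integral_of_le hs.le, MeasureTheory.integral_Ioc_eq_integral_Ioo]
    exact MeasureTheory.setIntegral_nonneg measurableSet_Ioo hsign
  have hcLo : 0 ≤ P sLo + ε * ∫ t in sLo..sHi, P t := by positivity
  have h1 := mul_nonneg (sub_nonneg.2 hLo) hcLo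
  have h2 := mul_nonneg (sub_nonneg.2 hHi) hPHi
  have h3 := mul_nonneg hβ (hid ▸ sub_nonneg.2 hεid)
  have hkey : L g - ε * J g = (g sLo - (α + β * sLo)) * (P sLo + ε * ∫ t in sLo..sHi, P t)
      + (g sHi - (α + β * sHi)) * P sHi + 2 * (∫ t in sLo..sHi, (g t - (α + β * t)) * D t)
      + β * (sLo * (P sLo + ε * ∫ t in sLo..sHi, P t) + sHi * P sHi
        + 2 * ∫ t in sLo..sHi, t * D t) := by
    rw [hLJ g hgc hgm, hsplit]
    linear_combination α * hone
  linarith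
end

section
/- (K-semistability claim in the proof of Theorem 3.1, non-horospherical case.) Suppose L(id) > 0, where id(t) = t. Then L(g) ≥ 0 for every non-decreasing convex continuous function g : [s₋, s₊] → ℝ. -/
theorem convexOn_div_affine {s : Set ℝ} (hs : Convex ℝ s) {b c w : ℝ} (hw : 0 ≤ w)
    (hpos : ∀ t ∈ s, 0 < b + c * t) : ConvexOn ℝ s fun t => w / (b + c * t) := by
  refine ⟨hs, fun x hx y hy p q hp hq hpq => ?_⟩
  have hu := hpos x hx
  have hv := hpos y hy
  have huv := hpos _ (hs hx hy hp hq hpq)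
  simp only [smul_eq_mul] at huv ⊢
  have hq' : q = 1 - p := by linarith
  have key : p * (w / (b + c * x)) + q * (w / (b + c * y)) - w / (b + c * (p * x + q * y))
      = w * (p * q * ((b + c * x) - (b + c * y)) ^ 2) /
        ((b + c * x) * (b + c * y) * (b + c * (p * x + q * y))) := by
    have h1 := hu.ne'
    have h2 := hv.ne'
    have h3 := huv.ne'
    subst hq'
    field_simp
    ring
  have : 0 ≤ w * (p * q * ((b + c * x) - (b + c * y)) ^ 2) /
        ((b + c * x) * (b + c * y) * (b + c * (p * x + q * y))) := by positivity
  linarith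

theorem convexOn_finset_sum {ι : Type*} (I : Finset ι) {s : Set ℝ} (hs : Convex ℝ s)
    {f : ι → ℝ → ℝ} (hf : ∀ i ∈ I, ConvexOn ℝ s (f i)) :
    ConvexOn ℝ s fun t => ∑ i ∈ I, f i t := by
  refine ⟨hs, fun x hx y hy p q hp hq hpq => ?_⟩
  simp only [Finset.smul_sum, ← Finset.sum_add_distrib]
  exact Finset.sum_le_sum fun i hi => (hf i hi).2 hx hy hp hq hpq

theorem ConvexOn.le_secant_of_mem_Icc {s : Set ℝ} {g : ℝ → ℝ} (hg : ConvexOn ℝ s g)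
    {x y t : ℝ} (hx : x ∈ s) (hy : y ∈ s) (hxy : x < y) (ht : t ∈ Set.Icc x y) :
    g t ≤ g x + (g y - g x) / (y - x) * (t - x) := by
  have hd : 0 < y - x := sub_pos.2 hxy
  rcases ht.1.eq_or_lt with rfl | hxt
  · simp
  rcases ht.2.eq_or_lt with rfl | hty
  · rw [div_mul_cancel₀ _ hd.ne']; linarith
  have h := hg.slope_mono_adjacent hx hy hxt hty
  rw [div_le_div_iff₀ (sub_pos.2 hxt) (sub_pos.2 hty)] at h
  rw [← sub_le_iff_le_add', div_mul_eq_mul_div, le_div_iff₀ hd]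
  linarith

theorem ConvexOn.secant_le_of_notMem_Ioo {s : Set ℝ} {g : ℝ → ℝ} (hg : ConvexOn ℝ s g)
    {x y t : ℝ} (hx : x ∈ s) (hy : y ∈ s) (ht : t ∈ s) (hxy : x < y)
    (hxyt : t ∉ Set.Ioo x y) :
    g x + (g y - g x) / (y - x) * (t - x) ≤ g t := by
  have hd : 0 < y - x := sub_pos.2 hxy
  have hmul : (g y - g x) / (y - x) * (y - x) = g y - g x := div_mul_cancel₀ _ hd.ne'
  rcases lt_trichotomy t x with htx | rfl | hxt
  · have h := hg.slope_mono_adjacent ht hy htx hxy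
    rw [div_le_iff₀ (sub_pos.2 htx)] at h
    linarith
  · simp
  · rcases (not_lt.1 fun h => hxyt ⟨hxt, h⟩ : y ≤ t).eq_or_lt with rfl | hyt
    · linarith
    · have h := hg.slope_mono_adjacent hx ht hxy hyt
      rw [le_div_iff₀ (sub_pos.2 hyt)] at h
      linarith

/-- On an open convex set `S` of reals cut out of `[u, v]`, a monotone convex function admits an
affine function of nonnegative slope lying above it on `S` and below it off `S`. -/
theorem exists_affine_separating {u v : ℝ} (huv : u ≤ v) {g : ℝ → ℝ}
    (hg : ConvexOn ℝ (Set.Icc u v) g) (hmono : MonotoneOn g (Set.Icc u v))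
    {S : Set ℝ} (hSo : IsOpen S) (hSc : Convex ℝ S) (hSs : S ⊆ Set.Icc u v) :
    ∃ p q : ℝ, 0 ≤ q ∧ (∀ t ∈ S, g t ≤ p + q * t) ∧
      ∀ t ∈ Set.Icc u v, t ∉ S → p + q * t ≤ g t := by
  rcases S.eq_empty_or_nonempty with rfl | hne
  · refine ⟨g u, 0, le_rfl, by simp, fun t ht _ => ?_⟩
    simpa using hmono ⟨le_rfl, huv⟩ ht ht.1
  have hbb : BddBelow S := ⟨u, fun t ht => (hSs ht).1⟩
  have hba : BddAbove S := ⟨v, fun t ht => (hSs ht).2⟩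
  have hlt : sInf S < sSup S := by
    obtain ⟨x, hx⟩ := hne
    obtain ⟨l, r, hlr, hsub⟩ := mem_nhds_iff_exists_Ioo_subset.1 (hSo.mem_nhds hx)
    have hm : (l + x) / 2 ∈ S := hsub ⟨by linarith [hlr.1], by linarith [hlr.1, hlr.2]⟩
    linarith [csInf_le hbb hm, le_csSup hba hx, hlr.1]
  have hα : sInf S ∈ Set.Icc u v :=
    ⟨le_csInf hne fun t ht => (hSs ht).1, hlt.le.trans (csSup_le hne fun t ht => (hSs ht).2)⟩
  have hβ : sSup S ∈ Set.Icc u v := ⟨hα.1.trans hlt.le, csSup_le hne fun t ht => (hSs ht).2⟩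
  have hIoo : Set.Ioo (sInf S) (sSup S) ⊆ S := fun t ht => by
    obtain ⟨x, hx, hxt⟩ := exists_lt_of_csInf_lt hne ht.1
    obtain ⟨y, hy, hty⟩ := exists_lt_of_lt_csSup hne ht.2
    exact hSc.ordConnected.out hx hy ⟨hxt.le, hty.le⟩
  have heq : ∀ A B C t : ℝ, A - B * C + B * t = A + B * (t - C) := fun A B C t => by ring
  refine ⟨g (sInf S) - (g (sSup S) - g (sInf S)) / (sSup S - sInf S) * sInf S,
    (g (sSup S) - g (sInf S)) / (sSup S - sInf S),
    div_nonneg (sub_nonneg.2 (hmono hα hβ hlt.le)) (sub_nonneg.2 hlt.le),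
    fun t ht => ?_, fun t ht htS => ?_⟩
  · rw [heq]
    exact hg.le_secant_of_mem_Icc hα hβ hlt ⟨csInf_le hbb ht, le_csSup hba ht⟩
  · rw [heq]
    exact hg.secant_le_of_notMem_Ioo hα hβ ht hlt fun h => htS (hIoo h)


/-- K-semistability claim in the proof of Theorem 3.1 of Delcroix's paper,
non-horospherical case: if `L(id) > 0` then `L(g) ≥ 0` for every non-decreasing
convex continuous `g : [s₋, s₊] → ℝ`. -/
theorem K_semistability_non_horospherical
    {ι : Type*} [Fintype ι] [DecidableEq ι] [Nonempty ι]
    (sLo sHi : ℝ) (hs : sLo < sHi)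
    (b c w : ι → ℝ)
    (hw : ∀ i, 0 < w i)
    (hpos : ∀ i, ∀ t ∈ Set.Ioo sLo sHi, 0 < b i + c i * t)
    (P Q : ℝ → ℝ)
    (hP : ∀ t, P t = ∏ i, (b i + c i * t) / w i)
    (hQ : ∀ t, Q t = ∑ i, ∏ j ∈ Finset.univ.erase i, (b j + c j * t) / w j)
    (a : ℝ)
    (ha : a = (P sLo + P sHi + 2 * ∫ t in sLo..sHi, Q t) / (2 * ∫ t in sLo..sHi, P t))
    (L : (ℝ → ℝ) → ℝ)
    (hL : ∀ g, L g = g sLo * P sLo + g sHi * P sHi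
      - ∫ t in sLo..sHi, 2 * g t * (a * P t - Q t))
    (hstab : L (fun t => t) > 0) :
    ∀ g : ℝ → ℝ, ContinuousOn g (Set.Icc sLo sHi) →
      ConvexOn ℝ (Set.Icc sLo sHi) g → MonotoneOn g (Set.Icc sLo sHi) →
        L g ≥ 0 := by
  intro g hgc hg hmono
  have hPc : Continuous P := by
    rw [funext hP]; fun_prop
  have hQc : Continuous Q := by
    rw [funext hQ]; fun_prop
  have hPpos : ∀ t ∈ Set.Ioo sLo sHi, 0 < P t := fun t ht => by
    rw [hP]
    exact Finset.prod_pos fun i _ => div_pos (hpos i t ht) (hw i)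
  have hPnn : ∀ t ∈ Set.Icc sLo sHi, 0 ≤ P t := by
    rw [← closure_Ioo hs.ne]
    exact fun t ht => closure_minimal (fun x hx => (hPpos x hx).le)
      (isClosed_le continuous_const hPc) ht
  have hQP : ∀ t ∈ Set.Ioo sLo sHi, Q t = (∑ i, w i / (b i + c i * t)) * P t := fun t ht => by
    rw [hQ, hP, Finset.sum_mul]
    refine Finset.sum_congr rfl fun i _ => ?_
    rw [← Finset.mul_prod_erase _ _ (Finset.mem_univ i), ← mul_assoc,
      div_mul_div_cancel₀ (hpos i t ht).ne', div_self (hw i).ne', one_mul]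
  have hφ : ConvexOn ℝ (Set.Ioo sLo sHi) fun t => ∑ i, w i / (b i + c i * t) :=
    convexOn_finset_sum _ (convex_Ioo _ _) fun i _ =>
      convexOn_div_affine (convex_Ioo _ _) (hw i).le (hpos i)
  have hsign : ∀ t ∈ Set.Ioo sLo sHi,
      0 < a * P t - Q t ↔ ∑ i, w i / (b i + c i * t) < a := fun t ht => by
    rw [hQP t ht, ← sub_mul, mul_pos_iff_of_pos_right (hPpos t ht), sub_pos]
  have hdc : Continuous fun t => a * P t - Q t := by fun_prop
  have hSeq : {t ∈ Set.Ioo sLo sHi | ∑ i, w i / (b i + c i * t) < a} =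
      Set.Ioo sLo sHi ∩ {t | 0 < a * P t - Q t} := by
    ext t
    exact and_congr_right fun ht => (hsign t ht).symm
  have hSc : Convex ℝ (Set.Ioo sLo sHi ∩ {t | 0 < a * P t - Q t}) :=
    hSeq ▸ hφ.convex_lt a
  obtain ⟨p, q, hq, hin, hout⟩ := exists_affine_separating hs.le hg hmono
    (isOpen_Ioo.inter (isOpen_lt continuous_const hdc)) hSc
    (Set.inter_subset_left.trans Set.Ioo_subset_Icc_self)
  have hPint : 0 < ∫ t in sLo..sHi, P t :=
    intervalIntegral.intervalIntegral_pos_of_pos_on (hPc.intervalIntegrable _ _) hPpos hs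
  have hmass : ∫ t in sLo..sHi, 2 * (a * P t - Q t) = P sLo + P sHi := by
    rw [intervalIntegral.integral_const_mul, intervalIntegral.integral_sub
      ((hPc.const_mul a).intervalIntegrable _ _) (hQc.intervalIntegrable _ _),
      intervalIntegral.integral_const_mul]
    rw [eq_div_iff (by positivity)] at ha
    linarith
  have hdiff : ContinuousOn (fun t => 2 * (g t - (p + q * t)) * (a * P t - Q t))
      (Set.uIcc sLo sHi) := by
    rw [Set.uIcc_of_le hs.le]; fun_prop
  have hsplit : ∫ t in sLo..sHi, 2 * g t * (a * P t - Q t) =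
      (∫ t in sLo..sHi, 2 * (g t - (p + q * t)) * (a * P t - Q t)) +
        (p * (P sLo + P sHi) + q * ∫ t in sLo..sHi, 2 * t * (a * P t - Q t)) := by
    rw [← hmass, ← intervalIntegral.integral_const_mul, ← intervalIntegral.integral_const_mul,
      ← intervalIntegral.integral_add (Continuous.intervalIntegrable (by fun_prop) _ _)
        (Continuous.intervalIntegrable (by fun_prop) _ _),
      ← intervalIntegral.integral_add hdiff.intervalIntegrable
        (Continuous.intervalIntegrable (by fun_prop) _ _)]
    refine intervalIntegral.integral_congr fun t _ => ?_
    ring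
  have hneg : ∫ t in sLo..sHi, 2 * (g t - (p + q * t)) * (a * P t - Q t) ≤ 0 := by
    rw [← neg_nonneg, ← intervalIntegral.integral_neg,
      intervalIntegral.integral_of_le hs.le, MeasureTheory.integral_Ioc_eq_integral_Ioo]
    refine MeasureTheory.setIntegral_nonneg measurableSet_Ioo fun t ht => ?_
    rcases lt_or_ge 0 (a * P t - Q t) with h | h
    · nlinarith [hin t ⟨ht, h⟩]
    · nlinarith [hout t (Set.Ioo_subset_Icc_self ht) fun h' => h'.2.not_ge h]
  have hLo := Set.left_mem_Icc.2 hs.le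
  have hHi := Set.right_mem_Icc.2 hs.le
  have h1 : (p + q * sLo) * P sLo ≤ g sLo * P sLo := mul_le_mul_of_nonneg_right
    (hout sLo hLo fun h => h.1.1.false) (hPnn sLo hLo)
  have h2 : (p + q * sHi) * P sHi ≤ g sHi * P sHi := mul_le_mul_of_nonneg_right
    (hout sHi hHi fun h => h.1.2.false) (hPnn sHi hHi)
  have h3 := mul_nonneg hq hstab.le
  rw [hL] at h3
  rw [hL, hsplit]
  linarith
end

section
/- (K-semistability claim in the proof of Theorem 3.1, horospherical case.) Suppose L(id) = 0, where id(t) = t. Then L(g) ≥ 0 for every convex continuous function g : [s₋, s₊] → ℝ. -/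
open MeasureTheory in
/-- A functional with nonnegative endpoint masses and density `-2h`, vanishing on affine functions,
is nonnegative on convex functions as soon as the set where `h` is positive is an interval. -/
theorem two_mul_integral_le_of_convexOn {u v p q : ℝ} (huv : u < v) (hp : 0 ≤ p) (hq : 0 ≤ q)
    {h : ℝ → ℝ} (hc : Continuous h) (hS : ({t ∈ Set.Ioo u v | 0 < h t}).OrdConnected)
    (h_one : p + q = ∫ t in u..v, 2 * h t)
    (h_id : u * p + v * q = ∫ t in u..v, 2 * t * h t)
    {g : ℝ → ℝ} (hg : ContinuousOn g (Set.Icc u v)) (hconv : ConvexOn ℝ (Set.Icc u v) g) :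
    ∫ t in u..v, 2 * g t * h t ≤ g u * p + g v * q := by
  obtain ⟨m, k, hu, hv, hmk⟩ : ∃ m k : ℝ, m + k * u ≤ g u ∧ m + k * v ≤ g v ∧
      ∀ t ∈ Set.Icc u v, 2 * g t * h t ≤ m * (2 * h t) + k * (2 * t * h t) ∨ t = u ∨ t = v := by
    by_cases hne : ∃ x ∈ Set.Ioo u v, 0 < h x
    · obtain ⟨x, hx, hhx⟩ := hne
      have hopen : IsOpen {t ∈ Set.Ioo u v | 0 < h t} :=
        isOpen_Ioo.inter (isOpen_lt continuous_const hc)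
      obtain ⟨y, hxy, hy⟩ := Filter.Eventually.exists_gt (hopen.mem_nhds ⟨hx, hhx⟩)
      set S := {t ∈ Set.Ioo u v | 0 < h t}
      have hbb : BddBelow S := ⟨u, fun t ht => ht.1.1.le⟩
      have hba : BddAbove S := ⟨v, fun t ht => ht.1.2.le⟩
      have hxS : x ∈ S := ⟨hx, hhx⟩
      set α := sInf S
      set β := sSup S
      have hαβ : α < β := (csInf_le hbb hxS).trans_lt (hxy.trans_le (le_csSup hba hy))
      have huα : u ≤ α := le_csInf ⟨x, hxS⟩ fun t ht => ht.1.1.le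
      have hβv : β ≤ v := csSup_le ⟨x, hxS⟩ fun t ht => ht.1.2.le
      have hαm : α ∈ Set.Icc u v := ⟨huα, hαβ.le.trans hβv⟩
      have hβm : β ∈ Set.Icc u v := ⟨huα.trans hαβ.le, hβv⟩
      obtain ⟨k, hk⟩ : ∃ k, (β - α) * k = g β - g α :=
        ⟨(g β - g α) / (β - α), by field_simp [(sub_pos.2 hαβ).ne']⟩
      have hd : 0 < β - α := sub_pos.2 hαβ
      have hleft : ∀ t ∈ Set.Icc u v, t ≤ α → g α - k * α + k * t ≤ g t := by
        intro t ht htα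
        rcases htα.eq_or_lt with rfl | hlt
        · linarith
        have := hconv.secant_mono_aux1 ht hβm hlt hαβ
        refine le_of_mul_le_mul_left ?_ hd
        linear_combination this - (α - t) * hk
      have hright : ∀ t ∈ Set.Icc u v, β ≤ t → g α - k * α + k * t ≤ g t := by
        intro t ht htβ
        rcases htβ.eq_or_lt with rfl | hlt
        · linarith
        have := hconv.secant_mono_aux1 hαm ht hαβ hlt
        refine le_of_mul_le_mul_left ?_ hd
        linear_combination this + (t - α) * hk
      refine ⟨g α - k * α, k, hleft u ⟨le_rfl, huv.le⟩ huα, hright v ⟨huv.le, le_rfl⟩ hβv, ?_⟩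
      intro t ht
      by_cases htu : t = u
      · exact .inr (.inl htu)
      by_cases htv : t = v
      · exact .inr (.inr htv)
      have hto : t ∈ Set.Ioo u v := ⟨ht.1.lt_of_ne' htu, ht.2.lt_of_ne htv⟩
      left
      rcases lt_trichotomy t α with hlt | rfl | hgt
      · have h1 : h t ≤ 0 := not_lt.1 fun hh => (csInf_le hbb ⟨hto, hh⟩).not_gt hlt
        linarith [mul_nonneg (sub_nonneg.2 (hleft t ht hlt.le)) (neg_nonneg.2 h1)]
      · linarith
      rcases lt_trichotomy t β with hlt' | rfl | hgt'
      · obtain ⟨y₁, hy₁, hy₁t⟩ := exists_lt_of_csInf_lt ⟨x, hxS⟩ hgt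
        obtain ⟨y₂, hy₂, hy₂t⟩ := exists_lt_of_lt_csSup ⟨x, hxS⟩ hlt'
        have htS : 0 < h t := (hS.out hy₁ hy₂ ⟨hy₁t.le, hy₂t.le⟩).2
        have := hconv.secant_mono_aux1 hαm hβm hgt hlt'
        have hle : g t ≤ g α - k * α + k * t := by
          refine le_of_mul_le_mul_left ?_ hd
          linear_combination this - (t - α) * hk
        linarith [mul_nonneg (sub_nonneg.2 hle) htS.le]
      · have : g β = g α - k * α + k * β := by linarith
        rw [this]
        linarith
      · have h1 : h t ≤ 0 := not_lt.1 fun hh => (le_csSup hba ⟨hto, hh⟩).not_gt hgt'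
        linarith [mul_nonneg (sub_nonneg.2 (hright t ht hgt'.le)) (neg_nonneg.2 h1)]
    · push Not at hne
      obtain ⟨z, -, hz⟩ := isCompact_Icc.exists_isMinOn (Set.nonempty_Icc.2 huv.le) hg
      have hz' : ∀ t ∈ Set.Icc u v, g z ≤ g t := fun t ht => hz ht
      refine ⟨g z, 0, by linarith [hz' u ⟨le_rfl, huv.le⟩], by linarith [hz' v ⟨huv.le, le_rfl⟩], ?_⟩
      intro t ht
      by_cases htu : t = u
      · exact .inr (.inl htu)
      by_cases htv : t = v
      · exact .inr (.inr htv)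
      have h1 := hne t ⟨ht.1.lt_of_ne' htu, ht.2.lt_of_ne htv⟩
      left
      linarith [mul_nonneg (sub_nonneg.2 (hz' t ht)) (neg_nonneg.2 h1)]
  have hi1 : IntervalIntegrable (fun t => m * (2 * h t)) volume u v :=
    (by fun_prop : Continuous fun t => m * (2 * h t)).intervalIntegrable _ _
  have hi2 : IntervalIntegrable (fun t => k * (2 * t * h t)) volume u v :=
    (by fun_prop : Continuous fun t => k * (2 * t * h t)).intervalIntegrable _ _
  have hig : IntervalIntegrable (fun t => 2 * g t * h t) volume u v := by
    refine ContinuousOn.intervalIntegrable_of_Icc huv.le ?_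
    exact (continuousOn_const.mul hg).mul hc.continuousOn
  have hle : ∫ t in u..v, 2 * g t * h t ≤
      ∫ t in u..v, (m * (2 * h t) + k * (2 * t * h t)) := by
    refine intervalIntegral.integral_mono_on_of_le_Ioo huv.le hig (hi1.add hi2) fun t ht => ?_
    rcases hmk t ⟨ht.1.le, ht.2.le⟩ with h1 | h1 | h1
    · exact h1
    · exact absurd h1 ht.1.ne'
    · exact absurd h1 ht.2.ne
  rw [intervalIntegral.integral_add hi1 hi2,
    intervalIntegral.integral_const_mul m fun t => 2 * h t,
    intervalIntegral.integral_const_mul k, ← h_one, ← h_id] at hle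
  linarith [mul_le_mul_of_nonneg_right hu hp, mul_le_mul_of_nonneg_right hv hq]

theorem convexOn_inv_affine {s : Set ℝ} (hs : Convex ℝ s) {b c : ℝ}
    (hpos : ∀ t ∈ s, 0 < b + c * t) : ConvexOn ℝ s fun t => (b + c * t)⁻¹ := by
  refine ⟨hs, fun x hx y hy α β hα hβ hαβ => ?_⟩
  have h := (convexOn_zpow (𝕜 := ℝ) (-1)).2 (hpos x hx) (hpos y hy) hα hβ hαβ
  simp only [zpow_neg_one, smul_eq_mul] at h ⊢
  rwa [show α * (b + c * x) + β * (b + c * y) = b + c * (α * x + β * y) by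
    linear_combination b * hαβ] at h


/-- K-semistability claim in the proof of Theorem 3.1 of Delcroix's paper,
horospherical case: if `L(id) = 0` (vanishing of the Futaki invariant) then
`L(g) ≥ 0` for every convex continuous `g : [s₋, s₊] → ℝ`. -/
theorem K_semistability_horospherical
    {ι : Type*} [Fintype ι] [DecidableEq ι] [Nonempty ι]
    (sLo sHi : ℝ) (hs : sLo < sHi)
    (b c w : ι → ℝ)
    (hw : ∀ i, 0 < w i)
    (hpos : ∀ i, ∀ t ∈ Set.Ioo sLo sHi, 0 < b i + c i * t)
    (P Q : ℝ → ℝ)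
    (hP : ∀ t, P t = ∏ i, (b i + c i * t) / w i)
    (hQ : ∀ t, Q t = ∑ i, ∏ j ∈ Finset.univ.erase i, (b j + c j * t) / w j)
    (a : ℝ)
    (ha : a = (P sLo + P sHi + 2 * ∫ t in sLo..sHi, Q t) / (2 * ∫ t in sLo..sHi, P t))
    (L : (ℝ → ℝ) → ℝ)
    (hL : ∀ g, L g = g sLo * P sLo + g sHi * P sHi
      - ∫ t in sLo..sHi, 2 * g t * (a * P t - Q t))
    (hstab : L (fun t => t) = 0) :
    ∀ g : ℝ → ℝ, ContinuousOn g (Set.Icc sLo sHi) →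
      ConvexOn ℝ (Set.Icc sLo sHi) g →
        L g ≥ 0 := by
  intro g hg hconv
  have hPc : Continuous P := by
    rw [funext hP]
    fun_prop
  have hQc : Continuous Q := by
    rw [funext hQ]
    fun_prop
  have hPpos : ∀ t ∈ Set.Ioo sLo sHi, 0 < P t := fun t ht => by
    rw [hP]
    exact Finset.prod_pos fun i _ => div_pos (hpos i t ht) (hw i)
  have hPnonneg : ∀ t ∈ Set.Icc sLo sHi, 0 ≤ P t := by
    rw [← closure_Ioo hs.ne]
    exact closure_minimal (fun t ht => (hPpos t ht).le) (isClosed_le continuous_const hPc)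
  have hPi : 0 < ∫ t in sLo..sHi, P t :=
    intervalIntegral.intervalIntegral_pos_of_pos_on (hPc.intervalIntegrable _ _) hPpos hs
  have hfac : ∀ t ∈ Set.Ioo sLo sHi,
      a * P t - Q t = P t * (a - ∑ i, w i * (b i + c i * t)⁻¹) := by
    intro t ht
    rw [mul_sub, Finset.mul_sum, hQ, mul_comm a]
    congr 1
    refine Finset.sum_congr rfl fun i hi => ?_
    rw [hP, ← Finset.mul_prod_erase _ _ hi]
    have h1 := (hpos i t ht).ne'
    have h2 := (hw i).ne'
    rw [mul_right_comm, show (b i + c i * t) / w i * (w i * (b i + c i * t)⁻¹) = 1 by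
      field_simp, one_mul]
  have hconc : ConcaveOn ℝ (Set.Ioo sLo sHi) fun t => a - ∑ i, w i * (b i + c i * t)⁻¹ := by
    refine (concaveOn_const a (convex_Ioo _ _)).sub ?_
    have hsum : ConvexOn ℝ (Set.Ioo sLo sHi) (∑ i, fun t => w i * (b i + c i * t)⁻¹) :=
      Finset.sum_induction _ (ConvexOn ℝ (Set.Ioo sLo sHi)) (fun _ _ => ConvexOn.add)
        (convexOn_const 0 (convex_Ioo _ _)) fun i _ =>
          (convexOn_inv_affine (convex_Ioo _ _) (hpos i)).smul (hw i).le
    exact hsum.congr fun t _ => Finset.sum_apply t _ _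
  have hS : ({t ∈ Set.Ioo sLo sHi | 0 < a * P t - Q t}).OrdConnected := by
    refine Eq.subst (Set.ext fun t => and_congr_right fun ht => ?_)
      (hconc.convex_gt 0).ordConnected
    rw [hfac t ht, mul_pos_iff_of_pos_left (hPpos t ht)]
  have h_one : P sLo + P sHi = ∫ t in sLo..sHi, 2 * (a * P t - Q t) := by
    rw [intervalIntegral.integral_const_mul, intervalIntegral.integral_sub
      ((hPc.intervalIntegrable _ _).const_mul a) (hQc.intervalIntegrable _ _),
      intervalIntegral.integral_const_mul]
    have h1 : a * (2 * ∫ t in sLo..sHi, P t) = P sLo + P sHi + 2 * ∫ t in sLo..sHi, Q t := by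
      rw [ha, div_mul_cancel₀ _ (by positivity)]
    linarith
  rw [hL] at hstab
  have key := two_mul_integral_le_of_convexOn hs (hPnonneg sLo ⟨le_rfl, hs.le⟩)
    (hPnonneg sHi ⟨hs.le, le_rfl⟩) ((hPc.const_mul a).sub hQc) hS h_one (sub_eq_zero.1 hstab)
    hg hconv
  rw [hL]
  exact sub_nonneg.2 key
end

section
/- For every real s with 0 < s < 1, one has 9s⁸ + 42s⁷ − 266s⁶ − 378s⁵ + 2135s⁴ + 1764s³ − 5292s² + 2646 > 0. -/
/-- Positivity of the K-stability polynomial for all Kähler classes `s·E + D₂`,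
`0 < s < 1`, on the discoloration of the two-orbit `PSL₂×G₂`-variety `𝕏₁`. -/
theorem K_stability_positivity_discoloration_X1 :
    ∀ s : ℝ, 0 < s → s < 1 →
      0 < 9 * s ^ 8 + 42 * s ^ 7 - 266 * s ^ 6 - 378 * s ^ 5 + 2135 * s ^ 4
          + 1764 * s ^ 3 - 5292 * s ^ 2 + 2646 := by
  intro s hs₀ hs₁
  have hs : 0 < 1 - s := sub_pos.mpr hs₁
  -- the expansion in the Bernstein basis of degree 8 has positive coefficients
  calc
    0 < 2646 * (1 - s) ^ 8 + 21168 * s * (1 - s) ^ 7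
          + 68796 * s ^ 2 * (1 - s) ^ 6
          + 118188 * s ^ 3 * (1 - s) ^ 5
          + 116795 * s ^ 4 * (1 - s) ^ 4 + 68138 * s ^ 5 * (1 - s) ^ 3
          + 23758 * s ^ 6 * (1 - s) ^ 2 + 5152 * s ^ 7 * (1 - s) + 660 * s ^ 8 := by
      positivity
    _ = _ := by ring
end

section
/- The definite integral ∫₀^8 (t−5)·t⁷·(256−t²)²·(64−t²)² dt equals 3672386428957884416/153153; in particular it is positive. -/
/-- The K-stability condition for the anticanonical polarization of the Picard rank
one, non-horospherical, two-orbit `F₄`-variety `𝕏₂`: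
`∫₀^8 (t−5)t⁷(256−t²)²(64−t²)² dt = 3672386428957884416/153153 > 0`. -/
theorem KE_integral_X2 :
    (∫ t in (0:ℝ)..8, (t - 5) * t ^ 7 * (256 - t ^ 2) ^ 2 * (64 - t ^ 2) ^ 2)
      = 3672386428957884416 / 153153 ∧
    0 < ∫ t in (0:ℝ)..8, (t - 5) * t ^ 7 * (256 - t ^ 2) ^ 2 * (64 - t ^ 2) ^ 2 := by
  have antideriv (x : ℝ) : HasDerivAt
      (fun t : ℝ ↦ -1342177280 * (t ^ 8 / 8) + 268435456 * (t ^ 9 / 9)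
        + 52428800 * (t ^ 10 / 10) - 10485760 * (t ^ 11 / 11) - 675840 * (t ^ 12 / 12)
        + 135168 * (t ^ 13 / 13) + 3200 * (t ^ 14 / 14) - 640 * (t ^ 15 / 15)
        - 5 * (t ^ 16 / 16) + t ^ 17 / 17)
      ((x - 5) * x ^ 7 * (256 - x ^ 2) ^ 2 * (64 - x ^ 2) ^ 2) x := by
    have monomial (n : ℕ) (c : ℝ) := ((hasDerivAt_pow n x).div_const (n : ℝ)).const_mul c
    have sum := (((((((((monomial 8 (-1342177280)).add (monomial 9 268435456)).add
      (monomial 10 52428800)).sub (monomial 11 10485760)).sub (monomial 12 675840)).add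
      (monomial 13 135168)).add (monomial 14 3200)).sub (monomial 15 640)).sub
      (monomial 16 5)).add (monomial 17 1)
    refine (sum.congr_deriv ?_).congr_of_eventuallyEq (Filter.Eventually.of_forall fun t ↦ ?_)
    · norm_num
      ring
    · simp
  have value : (∫ t in (0:ℝ)..8, (t - 5) * t ^ 7 * (256 - t ^ 2) ^ 2 * (64 - t ^ 2) ^ 2)
      = 3672386428957884416 / 153153 := by
    rw [intervalIntegral.integral_eq_sub_of_hasDerivAt (fun x _ ↦ antideriv x)
      (Continuous.intervalIntegrable (by fun_prop) _ _)]
    norm_num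
  refine ⟨value, ?_⟩
  rw [value]
  norm_num
end

section
/- Let P(t) = (1/2⁷)·t⁷·(4−t²)²·(1−t²)² and Q(t) = (1/2⁸)·t⁶·(4−t²)·(1−t²)·(13t⁵ + 22t⁴ − 105t³ − 110t² + 116t + 88). Then for every real s with 0 < s < 1, (s·P(s) + 2·∫₀^s t·Q(t) dt)·∫₀^s P(t) dt − (P(s) + 2·∫₀^s Q(t) dt)·∫₀^s t·P(t) dt > 0. -/
/-- Fundamental theorem of calculus for an antiderivative vanishing at the origin. -/
theorem integral_from_zero_eq_of_hasDerivAt {f F : ℝ → ℝ} (hf : Continuous f)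
    (hF : ∀ t, HasDerivAt F (f t) t) (hF0 : F 0 = 0) (s : ℝ) :
    ∫ t in (0:ℝ)..s, f t = F s := by
  rw [intervalIntegral.integral_eq_sub_of_hasDerivAt (fun t _ => hF t)
    (hf.intervalIntegrable 0 s), hF0, sub_zero]

/-- The rewritten K-stability condition (equation (1) of Delcroix's paper) for the
Kähler class `s·E + D₁`, `0 < s < 1`, on the discoloration of the two-orbit
`F₄`-variety `𝕏₂` is positive; hence this manifold is a strong Calabi dream
manifold. -/
theorem K_stability_positivity_discoloration_X2
    (P Q : ℝ → ℝ)
    (hP : ∀ t, P t = 1 / 2 ^ 7 * t ^ 7 * (4 - t ^ 2) ^ 2 * (1 - t ^ 2) ^ 2)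
    (hQ : ∀ t, Q t = 1 / 2 ^ 8 * t ^ 6 * (4 - t ^ 2) * (1 - t ^ 2)
      * (13 * t ^ 5 + 22 * t ^ 4 - 105 * t ^ 3 - 110 * t ^ 2 + 116 * t + 88)) :
    ∀ s : ℝ, 0 < s → s < 1 →
      0 < (s * P s + 2 * ∫ t in (0:ℝ)..s, t * Q t) * (∫ t in (0:ℝ)..s, P t)
        - (P s + 2 * ∫ t in (0:ℝ)..s, Q t) * (∫ t in (0:ℝ)..s, t * P t) := by
  obtain rfl : P = _ := funext hP
  obtain rfl : Q = _ := funext hQ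
  intro s hs0 hs1
  have hIP : ∫ t in (0:ℝ)..s, 1 / 2 ^ 7 * t ^ 7 * (4 - t ^ 2) ^ 2 * (1 - t ^ 2) ^ 2 =
      1 / 64 * s ^ 8 - 1 / 32 * s ^ 10 + 11 / 512 * s ^ 12 - 5 / 896 * s ^ 14
      + 1 / 2048 * s ^ 16 := by
    refine integral_from_zero_eq_of_hasDerivAt (F := fun t =>
        1 / 64 * t ^ 8 - 1 / 32 * t ^ 10 + 11 / 512 * t ^ 12 - 5 / 896 * t ^ 14
        + 1 / 2048 * t ^ 16) ?_ (fun t => ?_) ?_ s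
    · fun_prop
    · refine (DifferentiableAt.hasDerivAt (by fun_prop)).congr_deriv ?_
      simp (disch := fun_prop) only [deriv_fun_add, deriv_fun_sub, deriv_const_mul_field,
        deriv_fun_pow, deriv_id'']
      norm_num
      ring
    · norm_num
  have hItP : ∫ t in (0:ℝ)..s, t * (1 / 2 ^ 7 * t ^ 7 * (4 - t ^ 2) ^ 2 * (1 - t ^ 2) ^ 2) =
      1 / 72 * s ^ 9 - 5 / 176 * s ^ 11 + 33 / 1664 * s ^ 13 - 1 / 192 * s ^ 15
      + 1 / 2176 * s ^ 17 := by
    refine integral_from_zero_eq_of_hasDerivAt (F := fun t =>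
        1 / 72 * t ^ 9 - 5 / 176 * t ^ 11 + 33 / 1664 * t ^ 13 - 1 / 192 * t ^ 15
        + 1 / 2176 * t ^ 17) ?_ (fun t => ?_) ?_ s
    · fun_prop
    · refine (DifferentiableAt.hasDerivAt (by fun_prop)).congr_deriv ?_
      simp (disch := fun_prop) only [deriv_fun_add, deriv_fun_sub, deriv_const_mul_field,
        deriv_fun_pow, deriv_id'']
      norm_num
      ring
    · norm_num
  have hIQ : ∫ t in (0:ℝ)..s, 1 / 2 ^ 8 * t ^ 6 * (4 - t ^ 2) * (1 - t ^ 2)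
        * (13 * t ^ 5 + 22 * t ^ 4 - 105 * t ^ 3 - 110 * t ^ 2 + 116 * t + 88) =
      11 / 56 * s ^ 7 + 29 / 128 * s ^ 8 - 55 / 144 * s ^ 9 - 25 / 64 * s ^ 10
      + 33 / 128 * s ^ 11 + 231 / 1024 * s ^ 12 - 55 / 832 * s ^ 13 - 85 / 1792 * s ^ 14
      + 11 / 1920 * s ^ 15 + 13 / 4096 * s ^ 16 := by
    refine integral_from_zero_eq_of_hasDerivAt (F := fun t =>
        11 / 56 * t ^ 7 + 29 / 128 * t ^ 8 - 55 / 144 * t ^ 9 - 25 / 64 * t ^ 10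
        + 33 / 128 * t ^ 11 + 231 / 1024 * t ^ 12 - 55 / 832 * t ^ 13 - 85 / 1792 * t ^ 14
        + 11 / 1920 * t ^ 15 + 13 / 4096 * t ^ 16) ?_ (fun t => ?_) ?_ s
    · fun_prop
    · refine (DifferentiableAt.hasDerivAt (by fun_prop)).congr_deriv ?_
      simp (disch := fun_prop) only [deriv_fun_add, deriv_fun_sub, deriv_const_mul_field,
        deriv_fun_pow, deriv_id'']
      norm_num
      ring
    · norm_num
  have hItQ : ∫ t in (0:ℝ)..s, t * (1 / 2 ^ 8 * t ^ 6 * (4 - t ^ 2) * (1 - t ^ 2)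
        * (13 * t ^ 5 + 22 * t ^ 4 - 105 * t ^ 3 - 110 * t ^ 2 + 116 * t + 88)) =
      11 / 64 * s ^ 8 + 29 / 144 * s ^ 9 - 11 / 32 * s ^ 10 - 125 / 352 * s ^ 11
      + 121 / 512 * s ^ 12 + 693 / 3328 * s ^ 13 - 55 / 896 * s ^ 14 - 17 / 384 * s ^ 15
      + 11 / 2048 * s ^ 16 + 13 / 4352 * s ^ 17 := by
    refine integral_from_zero_eq_of_hasDerivAt (F := fun t =>
        11 / 64 * t ^ 8 + 29 / 144 * t ^ 9 - 11 / 32 * t ^ 10 - 125 / 352 * t ^ 11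
        + 121 / 512 * t ^ 12 + 693 / 3328 * t ^ 13 - 55 / 896 * t ^ 14 - 17 / 384 * t ^ 15
        + 11 / 2048 * t ^ 16 + 13 / 4352 * t ^ 17) ?_ (fun t => ?_) ?_ s
    · fun_prop
    · refine (DifferentiableAt.hasDerivAt (by fun_prop)).congr_deriv ?_
      simp (disch := fun_prop) only [deriv_fun_add, deriv_fun_sub, deriv_const_mul_field,
        deriv_fun_pow, deriv_id'']
      norm_num
      ring
    · norm_num
  have hs : 0 < 1 - s := sub_pos.mpr hs1
  have hbernstein : 0 < s ^ 16 / 1315253067448320 * (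
      173295682560 * (1 - s) ^ 16 + 2772730920960 * s * (1 - s) ^ 15
      + 19990887454720 * s ^ 2 * (1 - s) ^ 14 + 85833155932160 * s ^ 3 * (1 - s) ^ 13
      + 244357969623040 * s ^ 4 * (1 - s) ^ 12 + 486049582520320 * s ^ 5 * (1 - s) ^ 11
      + 693598609383680 * s ^ 6 * (1 - s) ^ 10 + 718157478438400 * s ^ 7 * (1 - s) ^ 9
      + 540158837325744 * s ^ 8 * (1 - s) ^ 8 + 293540730467712 * s ^ 9 * (1 - s) ^ 7
      + 114540471820992 * s ^ 10 * (1 - s) ^ 6 + 32338261642624 * s ^ 11 * (1 - s) ^ 5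
      + 6957360534896 * s ^ 12 * (1 - s) ^ 4 + 1254176718208 * s ^ 13 * (1 - s) ^ 3
      + 185260701904 * s ^ 14 * (1 - s) ^ 2 + 16833864608 * s ^ 15 * (1 - s)
      + 526058269 * s ^ 16) := by
    positivity
  rw [hIP, hItP, hIQ, hItQ]
  convert hbernstein using 1
  ring
end
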